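/- Let P be a symmetric GAP in ℝ of rank r ≥ 1 and let t ≥ 1. Then there exists a t-proper symmetric GAP Q in ℝ with rank(Q) ≤ r, Image(P) ⊆ Image(Q), and size(P) ≤ size(Q) ≤ (2t)^r · r^{6r²} · size(P). -/

import Mathlib

open MeasureTheory ProbabilityTheory Metric Finset Pointwise

/-- A symmetric generalized arithmetic progression (GAP) in a real vector space `E`,
given by its rank, dimensions and generators.  Its image is
`{m₁g₁ + ⋯ + m_l g_l : m_j ∈ ℤ, |m_j| ≤ L_j}`. -/
structure GAP (E : Type*) [AddCommGroup E] [Module ℝ E] where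
  rank : ℕ
  dims : Fin rank → ℝ
  gens : Fin rank → E

namespace GAP

variable {E : Type*} [AddCommGroup E] [Module ℝ E]

/-- The integer box `{m ∈ ℤ^l : |m_j| ≤ L_j}` of a GAP. -/
def box (P : GAP E) : Set (Fin P.rank → ℤ) :=
  {m | ∀ j, |(m j : ℝ)| ≤ P.dims j}

/-- The linear map `(m₁, …, m_l) ↦ m₁g₁ + ⋯ + m_l g_l` of a GAP. -/
noncomputable def toFun (P : GAP E) (m : Fin P.rank → ℤ) : E :=
  ∑ j, (m j : ℝ) • P.gens j

/-- The image of a GAP. -/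
noncomputable def image (P : GAP E) : Set E :=
  P.toFun '' P.box

/-- The dilate `P^t` of a GAP. -/
def dilate (P : GAP E) (t : ℝ) : GAP E :=
  ⟨P.rank, fun j => t * P.dims j, P.gens⟩

/-- A GAP is proper if `(m₁, …, m_l) ↦ Σ m_j g_j` is injective on the integer box. -/
def Proper (P : GAP E) : Prop :=
  Set.InjOn P.toFun P.box

/-- A GAP is `t`-proper if its dilate `P^t` is proper. -/
def TProper (P : GAP E) (t : ℝ) : Prop :=
  (P.dilate t).Proper

/-- A GAP is infinitely proper if it is `t`-proper for every `t > 0`. -/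
def InfinitelyProper (P : GAP E) : Prop :=
  ∀ t : ℝ, 0 < t → P.TProper t

/-- The size of a GAP: the number of elements of its image. -/
noncomputable def size (P : GAP E) : ℕ :=
  P.image.ncard

end GAP

section Lattice

open scoped InnerProductSpace

variable {E : Type*} [NormedAddCommGroup E]

/-- An additive subgroup is locally finite if it meets every ball in finitely many points. -/
def LocallyFiniteGroup (Λ : AddSubgroup E) : Prop :=
  ∀ R : ℝ, {x : E | x ∈ Λ ∧ ‖x‖ ≤ R}.Finite

theorem LocallyFiniteGroup.exists_shortest {Λ : AddSubgroup E} (hΛ : LocallyFiniteGroup Λ)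
    {x₀ : E} (hx₀ : x₀ ∈ Λ) (h0 : x₀ ≠ 0) :
    ∃ v ∈ Λ, v ≠ 0 ∧ ∀ x ∈ Λ, x ≠ 0 → ‖v‖ ≤ ‖x‖ := by
  have hfin : {x : E | (x ∈ Λ ∧ ‖x‖ ≤ ‖x₀‖) ∧ x ≠ 0}.Finite :=
    (hΛ ‖x₀‖).subset fun x hx => hx.1
  obtain ⟨v, ⟨⟨hvΛ, hvn⟩, hv⟩, hmin⟩ :=
    Set.exists_min_image _ (fun x : E => ‖x‖) hfin ⟨x₀, ⟨hx₀, le_rfl⟩, h0⟩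
  refine ⟨v, hvΛ, hv, fun x hx hx0 => ?_⟩
  by_cases h : ‖x‖ ≤ ‖x₀‖
  · exact hmin x ⟨⟨hx, h⟩, hx0⟩
  · exact hvn.trans (not_le.mp h).le

variable [InnerProductSpace ℝ E]

/-- The projection of `E` along `v` onto the orthogonal complement of `v`. -/
noncomputable def projAlong (v : E) : E →ₗ[ℝ] E :=
  LinearMap.id - (‖v‖ ^ 2)⁻¹ • (innerₗ E v).smulRight v

theorem projAlong_apply (v x : E) :
    projAlong v x = x - ((‖v‖ ^ 2)⁻¹ * ⟪v, x⟫_ℝ) • v := by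
  simp [projAlong, mul_smul]

theorem inner_projAlong {v : E} (hv : v ≠ 0) (x : E) : ⟪v, projAlong v x⟫_ℝ = 0 := by
  have h : ‖v‖ ≠ 0 := norm_ne_zero_iff.mpr hv
  rw [projAlong_apply, inner_sub_right, inner_smul_right, real_inner_self_eq_norm_sq]
  field_simp
  ring

theorem projAlong_self {v : E} (hv : v ≠ 0) : projAlong v v = 0 := by
  have h : ‖v‖ ≠ 0 := norm_ne_zero_iff.mpr hv
  rw [projAlong_apply, real_inner_self_eq_norm_sq, inv_mul_cancel₀ (by positivity), one_smul,
    sub_self]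

theorem norm_sq_add_smul_of_inner_eq_zero {v y : E} (h : ⟪v, y⟫_ℝ = 0) (c : ℝ) :
    ‖y + c • v‖ ^ 2 = ‖y‖ ^ 2 + c ^ 2 * ‖v‖ ^ 2 := by
  rw [norm_add_sq_real, inner_smul_right, real_inner_comm, h, norm_smul, mul_pow,
    Real.norm_eq_abs, sq_abs]
  ring

theorem norm_projAlong_le {v : E} (hv : v ≠ 0) (x : E) : ‖projAlong v x‖ ≤ ‖x‖ := by
  have h := norm_sq_add_smul_of_inner_eq_zero (inner_projAlong hv x) ((‖v‖ ^ 2)⁻¹ * ⟪v, x⟫_ℝ)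
  rw [projAlong_apply, sub_add_cancel, ← projAlong_apply] at h
  refine le_of_sq_le_sq ?_ (norm_nonneg _)
  rw [h]
  exact le_add_of_nonneg_right (by positivity)

/-- The image of an additive subgroup under the projection along `v`. -/
noncomputable def projGroup (Λ : AddSubgroup E) (v : E) : AddSubgroup E :=
  Λ.map (projAlong v).toAddMonoidHom

theorem projAlong_mem_projGroup {Λ : AddSubgroup E} (v : E) {x : E} (hx : x ∈ Λ) :
    projAlong v x ∈ projGroup Λ v :=
  ⟨x, hx, rfl⟩

/-- Every element of the projected group has a lift differing from it by at most half of `v`. -/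
theorem exists_lift_of_mem_projGroup {Λ : AddSubgroup E} {v : E} (hvΛ : v ∈ Λ) (hv : v ≠ 0)
    {y : E} (hy : y ∈ projGroup Λ v) :
    ∃ c : ℝ, |c| ≤ 1 / 2 ∧ y + c • v ∈ Λ ∧ projAlong v (y + c • v) = y ∧ ⟪v, y⟫_ℝ = 0 := by
  obtain ⟨x, hx, rfl⟩ := hy
  change ∃ c : ℝ, |c| ≤ 1 / 2 ∧ projAlong v x + c • v ∈ Λ ∧
    projAlong v (projAlong v x + c • v) = projAlong v x ∧ ⟪v, projAlong v x⟫_ℝ = 0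
  have h0 := inner_projAlong hv x
  set a : ℝ := (‖v‖ ^ 2)⁻¹ * ⟪v, x⟫_ℝ with ha
  refine ⟨a - round a, abs_sub_round a, ?_, ?_, h0⟩
  · have : projAlong v x + (a - round a) • v = x - round a • v := by
      rw [projAlong_apply, ← ha, sub_smul, Int.cast_smul_eq_zsmul]
      abel
    rw [this]
    exact Λ.sub_mem hx (Λ.zsmul_mem hvΛ _)
  · rw [map_add, map_smul, projAlong_self hv, smul_zero, add_zero, projAlong_apply v (projAlong v x),
      h0, mul_zero, zero_smul, sub_zero]

theorem norm_add_smul_le_of_inner_eq_zero {v y : E} (h : ⟪v, y⟫_ℝ = 0) {c : ℝ}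
    (hc : |c| ≤ 1 / 2) : ‖y + c • v‖ ^ 2 ≤ ‖y‖ ^ 2 + ‖v‖ ^ 2 / 4 := by
  rw [norm_sq_add_smul_of_inner_eq_zero h]
  have : c ^ 2 ≤ 1 / 4 := by
    rw [← sq_abs]
    nlinarith [abs_nonneg c]
  nlinarith [sq_nonneg ‖v‖]

theorem LocallyFiniteGroup.map_projAlong {Λ : AddSubgroup E} (hΛ : LocallyFiniteGroup Λ) {v : E}
    (hvΛ : v ∈ Λ) (hv : v ≠ 0) : LocallyFiniteGroup (projGroup Λ v) := by
  intro R
  refine ((hΛ (R + ‖v‖)).image (projAlong v)).subset ?_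
  rintro y ⟨hy, hyR⟩
  obtain ⟨c, hc, hmem, hproj, -⟩ := exists_lift_of_mem_projGroup hvΛ hv hy
  refine ⟨_, ⟨hmem, ?_⟩, hproj⟩
  calc ‖y + c • v‖ ≤ ‖y‖ + ‖c • v‖ := norm_add_le _ _
    _ ≤ R + ‖v‖ := by
      rw [norm_smul, Real.norm_eq_abs]
      nlinarith [norm_nonneg v]

theorem finrank_span_projGroup_lt [FiniteDimensional ℝ E] {Λ : AddSubgroup E} {v : E}
    (hvΛ : v ∈ Λ) (hv : v ≠ 0) :
    Module.finrank ℝ (Submodule.span ℝ (projGroup Λ v : Set E)) <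
      Module.finrank ℝ (Submodule.span ℝ (Λ : Set E)) := by
  apply Submodule.finrank_lt_finrank_of_lt
  have hvs : v ∈ Submodule.span ℝ (Λ : Set E) := Submodule.subset_span hvΛ
  refine lt_of_le_of_ne (Submodule.span_le.mpr ?_) ?_
  · rintro _ ⟨x, hx, rfl⟩
    change projAlong v x ∈ _
    rw [projAlong_apply]
    exact Submodule.sub_mem _ (Submodule.subset_span hx) (Submodule.smul_mem _ _ hvs)
  · intro h
    have hle : Submodule.span ℝ (projGroup Λ v : Set E) ≤ LinearMap.ker (innerₗ E v) := by
      refine Submodule.span_le.mpr ?_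
      rintro _ ⟨x, hx, rfl⟩
      exact inner_projAlong hv x
    rw [← h] at hvs
    exact hv (inner_self_eq_zero.mp (hle hvs))

/-- A locally finite subgroup has a basis in which each term of an expansion is controlled by the
norm of the sum. -/
theorem LocallyFiniteGroup.exists_reduced_basis [FiniteDimensional ℝ E] (n : ℕ) :
    ∀ Λ : AddSubgroup E, LocallyFiniteGroup Λ →
      Module.finrank ℝ (Submodule.span ℝ (Λ : Set E)) ≤ n →
      ∃ d ≤ n, ∃ b : Fin d → E, (∀ j, b j ≠ 0) ∧ (∀ j, b j ∈ Λ) ∧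
        (∀ x ∈ Λ, ∃ m : Fin d → ℤ, x = ∑ j, (m j : ℝ) • b j) ∧
        ∀ (m : Fin d → ℤ) (j : Fin d),
          |(m j : ℝ)| * ‖b j‖ ≤ 2 ^ n * n.factorial * ‖∑ j, (m j : ℝ) • b j‖ := by
  induction n with
  | zero =>
    intro Λ _ hrank
    refine ⟨0, le_rfl, Fin.elim0, fun j => j.elim0, fun j => j.elim0, fun x hx => ?_,
      fun m j => j.elim0⟩
    have hbot := Submodule.finrank_eq_zero.mp (Nat.le_zero.mp hrank)
    have hxs : x ∈ Submodule.span ℝ (Λ : Set E) := Submodule.subset_span hx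
    rw [hbot, Submodule.mem_bot] at hxs
    exact ⟨Fin.elim0, by simp [hxs]⟩
  | succ n ih =>
    intro Λ hΛ hrank
    by_cases htriv : ∀ x ∈ Λ, x = 0
    · exact ⟨0, Nat.zero_le _, Fin.elim0, fun j => j.elim0, fun j => j.elim0,
        fun x hx => ⟨Fin.elim0, by simp [htriv x hx]⟩, fun m j => j.elim0⟩
    push Not at htriv
    obtain ⟨x₀, hx₀, hx₀'⟩ := htriv
    obtain ⟨v, hvΛ, hv, hmin⟩ := hΛ.exists_shortest hx₀ hx₀'
    have hlt := finrank_span_projGroup_lt hvΛ hv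
    obtain ⟨d, hd, b, hb0, hbΛ, hgen, hbd⟩ :=
      ih (projGroup Λ v) (hΛ.map_projAlong hvΛ hv) (by omega)
    choose c hc hyΛ hproj horth using fun j => exists_lift_of_mem_projGroup hvΛ hv (hbΛ j)
    set y : Fin d → E := fun j => b j + c j • v with hy
    have hy0 : ∀ j, y j ≠ 0 := fun j h => hb0 j (by
      rw [← hproj j]
      change projAlong v (y j) = 0
      rw [h, map_zero])
    have hvy : ∀ j, ‖v‖ ≤ ‖y j‖ := fun j => hmin _ (hyΛ j) (hy0 j)
    have hyb : ∀ j, ‖y j‖ ≤ 2 * ‖b j‖ := fun j => by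
      have h1 := norm_add_smul_le_of_inner_eq_zero (horth j) (hc j)
      have h2 := pow_le_pow_left₀ (norm_nonneg v) (hvy j) 2
      change ‖y j‖ ^ 2 ≤ _ at h1
      refine le_of_sq_le_sq ?_ (by positivity)
      nlinarith [sq_nonneg ‖b j‖]
    have hvpos : 0 < ‖v‖ := norm_pos_iff.mpr hv
    set C : ℝ := 2 ^ n * n.factorial with hC
    have hC1 : 1 ≤ C := one_le_mul_of_one_le_of_one_le (one_le_pow₀ (by norm_num))
      (by exact_mod_cast Nat.factorial_pos n)
    have hCsucc : (2 : ℝ) ^ (n + 1) * (n + 1).factorial = 2 * (n + 1) * C := by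
      rw [hC, Nat.factorial_succ]
      push_cast
      ring
    refine ⟨d + 1, by omega, Fin.cons v y, ?_, ?_, ?_, ?_⟩
    · exact Fin.cases hv hy0
    · exact Fin.cases hvΛ hyΛ
    · intro x hx
      obtain ⟨m, hm⟩ := hgen _ (projAlong_mem_projGroup v hx)
      have hxΛ : x - ∑ j, (m j : ℝ) • y j ∈ Λ := by
        refine Λ.sub_mem hx (Λ.sum_mem fun j _ => ?_)
        rw [Int.cast_smul_eq_zsmul]
        exact Λ.zsmul_mem (hyΛ j) _
      have hxproj : projAlong v (x - ∑ j, (m j : ℝ) • y j) = 0 := by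
        rw [map_sub, map_sum, hm]
        simp only [map_smul]
        rw [sub_eq_zero]
        exact Finset.sum_congr rfl fun j _ => by rw [hproj j]
      set z := x - ∑ j, (m j : ℝ) • y j with hz
      rw [projAlong_apply, sub_eq_zero] at hxproj
      set a : ℝ := (‖v‖ ^ 2)⁻¹ * ⟪v, z⟫_ℝ
      have hza : z - (round a : ℝ) • v = 0 := by
        by_contra hne
        have hmem : z - (round a : ℝ) • v ∈ Λ := by
          rw [Int.cast_smul_eq_zsmul]
          exact Λ.sub_mem hxΛ (Λ.zsmul_mem hvΛ _)
        have h1 := hmin _ hmem hne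
        rw [hxproj, ← sub_smul, norm_smul, Real.norm_eq_abs] at h1
        nlinarith [abs_sub_round a]
      refine ⟨Fin.cons (round a) m, ?_⟩
      rw [Fin.sum_univ_succ]
      simp only [Fin.cons_zero, Fin.cons_succ]
      rw [← sub_eq_zero.mp hza, hz]
      abel
    · intro m
      rw [hCsucc, Fin.sum_univ_succ]
      simp only [Fin.cons_zero, Fin.cons_succ]
      set x : E := (m 0 : ℝ) • v + ∑ j : Fin d, (m j.succ : ℝ) • y j with hx
      have hxproj : projAlong v x = ∑ j : Fin d, (m j.succ : ℝ) • b j := by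
        rw [hx, map_add, map_smul, projAlong_self hv, smul_zero, zero_add, map_sum]
        exact Finset.sum_congr rfl fun j _ => by rw [map_smul, hproj j]
      have htail : ∀ j : Fin d, |(m j.succ : ℝ)| * ‖y j‖ ≤ 2 * C * ‖x‖ := fun j => by
        have h1 := hbd (fun j => m j.succ) j
        rw [← hxproj] at h1
        have h2 := mul_le_mul_of_nonneg_left (norm_projAlong_le hv x) (zero_le_one.trans hC1)
        have h3 := mul_le_mul_of_nonneg_left (hyb j) (abs_nonneg (m j.succ : ℝ))
        linarith
      have hdn : (d : ℝ) ≤ n := by exact_mod_cast hd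
      have hx0 := norm_nonneg x
      have hCx : 0 ≤ C * ‖x‖ := by positivity
      refine Fin.cases ?_ fun j => ?_
      · simp only [Fin.cons_zero]
        have hinner : ⟪v, x⟫_ℝ = (m 0 + ∑ j : Fin d, m j.succ * c j) * ‖v‖ ^ 2 := by
          rw [hx, inner_add_right, inner_sum, inner_smul_right, real_inner_self_eq_norm_sq, add_mul,
            Finset.sum_mul]
          congr 1
          refine Finset.sum_congr rfl fun j _ => ?_
          rw [hy, inner_smul_right, inner_add_right, horth j, inner_smul_right,
            real_inner_self_eq_norm_sq]
          ring
        have hcs : |(m 0 : ℝ) + ∑ j : Fin d, m j.succ * c j| * ‖v‖ ≤ ‖x‖ := by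
          have h1 := abs_real_inner_le_norm v x
          rw [hinner, abs_mul, abs_of_nonneg (sq_nonneg ‖v‖)] at h1
          refine le_of_mul_le_mul_left ?_ hvpos
          linarith
        have hsum : |∑ j : Fin d, (m j.succ : ℝ) * c j| * ‖v‖ ≤ d * (C * ‖x‖) := by
          calc |∑ j : Fin d, (m j.succ : ℝ) * c j| * ‖v‖
              ≤ (∑ j : Fin d, |(m j.succ : ℝ) * c j|) * ‖v‖ := by
                gcongr
                exact Finset.abs_sum_le_sum_abs _ _
            _ = ∑ j : Fin d, |(m j.succ : ℝ) * c j| * ‖v‖ := Finset.sum_mul _ _ _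
            _ ≤ ∑ _j : Fin d, C * ‖x‖ := by
                refine Finset.sum_le_sum fun j _ => ?_
                rw [abs_mul]
                have h1 := htail j
                have h2 := mul_le_mul_of_nonneg_left (hvy j) (abs_nonneg (m j.succ : ℝ))
                have h3 := mul_le_mul_of_nonneg_left (hc j)
                  (mul_nonneg (abs_nonneg (m j.succ : ℝ)) hvpos.le)
                linarith
            _ = d * (C * ‖x‖) := by simp
        have htri : |(m 0 : ℝ)| ≤ |(m 0 : ℝ) + ∑ j : Fin d, m j.succ * c j| +
            |∑ j : Fin d, (m j.succ : ℝ) * c j| := by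
          have := abs_sub ((m 0 : ℝ) + ∑ j : Fin d, m j.succ * c j)
            (∑ j : Fin d, (m j.succ : ℝ) * c j)
          rwa [add_sub_cancel_right] at this
        have h1 := mul_le_mul_of_nonneg_right htri hvpos.le
        have h2 := mul_le_mul_of_nonneg_right hdn hCx
        have h3 := mul_le_mul_of_nonneg_right hC1 hx0
        have h4 : (0 : ℝ) ≤ n * (C * ‖x‖) := by positivity
        linarith
      · simp only [Fin.cons_succ]
        have h1 := htail j
        have h4 : (0 : ℝ) ≤ n * (C * ‖x‖) := by positivity
        linarith

/-- Successively projecting along short kernel vectors of `φ` gives a locally finite subgroup on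
which `φ` has no nonzero kernel vector of norm at most `τ`, without changing the values of `φ`. -/
theorem LocallyFiniteGroup.exists_no_short_kernel [FiniteDimensional ℝ E] (φ : E →ₗ[ℝ] ℝ) (τ : ℝ)
    (n : ℕ) :
    ∀ Λ : AddSubgroup E, LocallyFiniteGroup Λ →
      Module.finrank ℝ (Submodule.span ℝ (Λ : Set E)) ≤ n →
      ∃ Λ' : AddSubgroup E, LocallyFiniteGroup Λ' ∧
        Module.finrank ℝ (Submodule.span ℝ (Λ' : Set E)) ≤ n ∧
        (∀ x ∈ Λ, ∃ y ∈ Λ', ‖y‖ ≤ ‖x‖ ∧ φ y = φ x) ∧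
        (∀ y ∈ Λ', ∃ x ∈ Λ, ‖x‖ ^ 2 ≤ ‖y‖ ^ 2 + n * (τ ^ 2 / 4) ∧ φ x = φ y) ∧
        ∀ y ∈ Λ', φ y = 0 → ‖y‖ ≤ τ → y = 0 := by
  induction n with
  | zero =>
    intro Λ hΛ hrank
    refine ⟨Λ, hΛ, hrank, fun x hx => ⟨x, hx, le_rfl, rfl⟩, fun x hx => ⟨x, hx, by simp, rfl⟩,
      fun x hx _ _ => ?_⟩
    have hbot := Submodule.finrank_eq_zero.mp (Nat.le_zero.mp hrank)
    have hxs : x ∈ Submodule.span ℝ (Λ : Set E) := Submodule.subset_span hx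
    rwa [hbot, Submodule.mem_bot] at hxs
  | succ n ih =>
    intro Λ hΛ hrank
    by_cases hker : ∀ y ∈ Λ, φ y = 0 → ‖y‖ ≤ τ → y = 0
    · exact ⟨Λ, hΛ, hrank, fun x hx => ⟨x, hx, le_rfl, rfl⟩,
        fun x hx => ⟨x, hx, le_add_of_nonneg_right (by positivity), rfl⟩, hker⟩
    push Not at hker
    obtain ⟨v, hvΛ, hφ, hvτ, hv⟩ := hker
    have hlt := finrank_span_projGroup_lt hvΛ hv
    obtain ⟨Λ', hΛ', hrank', hdown, hup, hker'⟩ :=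
      ih (projGroup Λ v) (hΛ.map_projAlong hvΛ hv) (by omega)
    refine ⟨Λ', hΛ', by omega, fun x hx => ?_, fun y hy => ?_, hker'⟩
    · obtain ⟨y, hy, hyn, hyφ⟩ := hdown _ (projAlong_mem_projGroup v hx)
      refine ⟨y, hy, hyn.trans (norm_projAlong_le hv x), ?_⟩
      rw [hyφ, projAlong_apply, map_sub, map_smul, hφ, smul_zero, sub_zero]
    · obtain ⟨x, hx, hxn, hxφ⟩ := hup y hy
      obtain ⟨c, hc, hmem, -, horth⟩ := exists_lift_of_mem_projGroup hvΛ hv hx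
      refine ⟨_, hmem, ?_, ?_⟩
      · have h1 := norm_add_smul_le_of_inner_eq_zero horth hc
        have h2 := pow_le_pow_left₀ (norm_nonneg v) hvτ 2
        push_cast
        linarith
      · rw [map_add, map_smul, hφ, smul_zero, add_zero, hxφ]

end Lattice
namespace GAP

theorem finite_box {F : Type*} [AddCommGroup F] [Module ℝ F] (P : GAP F) : P.box.Finite := by
  refine (Set.Finite.pi' fun j => Set.finite_Icc (-⌊P.dims j⌋) ⌊P.dims j⌋).subset fun m hm j => ?_
  have h := abs_le.mp (hm j)
  refine ⟨?_, Int.le_floor.mpr h.2⟩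
  rw [neg_le, Int.le_floor]
  push_cast
  linarith

theorem finite_image {F : Type*} [AddCommGroup F] [Module ℝ F] (P : GAP F) : P.image.Finite :=
  P.finite_box.image _

theorem zero_mem_image {F : Type*} [AddCommGroup F] [Module ℝ F] (P : GAP F)
    (hdims : ∀ j, 0 < P.dims j) : 0 ∈ P.image :=
  ⟨0, fun j => by simpa using (hdims j).le, by simp [toFun]⟩

theorem one_le_size {F : Type*} [AddCommGroup F] [Module ℝ F] (P : GAP F)
    (hdims : ∀ j, 0 < P.dims j) : 1 ≤ P.size :=
  (Set.ncard_pos P.finite_image).mpr ⟨0, P.zero_mem_image hdims⟩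

/-- Division with remainder of an integer in `[-TL, TL]` by the length of `[-L, L] ∩ ℤ`. -/
theorem exists_centered_division {L T : ℝ} (hL : 0 < L) (hT : 1 ≤ T) {m : ℤ}
    (hm : |(m : ℝ)| ≤ T * L) :
    ∃ q s : ℤ, m = q * (2 * ⌊L⌋ + 1) + s ∧ |(s : ℝ)| ≤ L ∧ |(q : ℝ)| ≤ T + 1 / 2 := by
  have hl0 : 0 ≤ ⌊L⌋ := Int.floor_nonneg.mpr hL.le
  have hl0' : (0 : ℝ) ≤ ⌊L⌋ := by exact_mod_cast hl0
  have hl1 := Int.floor_le L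
  have hl2 := Int.lt_floor_add_one L
  set l := ⌊L⌋
  set k : ℤ := 2 * l + 1 with hk
  have hkpos : 0 < k := by omega
  have hkR : (k : ℝ) = 2 * l + 1 := by rw [hk]; push_cast; ring
  refine ⟨(m + l) / k, (m + l) % k - l, ?_, ?_, ?_⟩
  · have := Int.emod_add_mul_ediv (m + l) k
    linarith
  · have h1 := Int.emod_nonneg (m + l) hkpos.ne'
    have h2 := Int.emod_lt_of_pos (m + l) hkpos
    have h3 : |(m + l) % k - l| ≤ l := abs_le.mpr ⟨by omega, by omega⟩
    have h4 : |(((m + l) % k - l : ℤ) : ℝ)| ≤ l := by exact_mod_cast h3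
    exact h4.trans hl1
  · have h0 := Int.emod_add_mul_ediv (m + l) k
    have h1 := Int.emod_nonneg (m + l) hkpos.ne'
    have h2 := Int.emod_lt_of_pos (m + l) hkpos
    set q := (m + l) / k
    have h3 : k * q ≤ m + l := by linarith
    have h4 : m + l + 1 ≤ k * q + k := by omega
    have h3' : (k : ℝ) * q ≤ m + l := by exact_mod_cast h3
    have h4' : (m : ℝ) + l + 1 ≤ k * q + k := by exact_mod_cast h4
    obtain ⟨h5, h6⟩ := abs_le.mp hm
    have hkR0 : (0 : ℝ) < k := by exact_mod_cast hkpos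
    have h7 : T * L ≤ T * k := by nlinarith
    refine abs_le.mpr ⟨?_, ?_⟩
    · by_contra hcon
      push Not at hcon
      nlinarith
    · by_contra hcon
      push Not at hcon
      nlinarith

/-- Covering a dilate of a GAP by translates of the GAP. -/
theorem size_dilate_le {F : Type*} [AddCommGroup F] [Module ℝ F] (P : GAP F)
    (hdims : ∀ j, 0 < P.dims j) {T : ℝ} (hT : 1 ≤ T) :
    ((P.dilate T).size : ℝ) ≤ (4 * T) ^ P.rank * P.size := by
  set N : ℤ := ⌊T + 1 / 2⌋ with hN
  have hN0 : 0 ≤ N := Int.floor_nonneg.mpr (by linarith)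
  set S : Finset (Fin P.rank → ℤ) := Fintype.piFinset fun _ => Finset.Icc (-N) N with hS
  have hScard : (S.card : ℝ) ≤ (4 * T) ^ P.rank := by
    rw [hS, Fintype.card_piFinset, Finset.prod_const, Finset.card_univ, Fintype.card_fin,
      Int.card_Icc, Nat.cast_pow]
    refine pow_le_pow_left₀ (Nat.cast_nonneg _) ?_ _
    have h1 : (((N + 1 - -N).toNat : ℤ) : ℝ) = 2 * N + 1 := by
      rw [Int.toNat_of_nonneg (by omega)]
      push_cast
      ring
    rw [Int.cast_natCast] at h1
    rw [h1]
    have h2 := Int.floor_le (T + 1 / 2)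
    linarith
  set f : (Fin P.rank → ℤ) × F → F :=
    fun p => P.toFun (fun j => p.1 j * (2 * ⌊P.dims j⌋ + 1)) + p.2 with hf
  have hsub : (P.dilate T).image ⊆ f '' ((S : Set (Fin P.rank → ℤ)) ×ˢ P.image) := by
    rintro _ ⟨m, hm, rfl⟩
    choose q s hqs hs hq using fun j => exists_centered_division (hdims j) hT (hm j)
    refine ⟨(q, P.toFun s), ⟨?_, s, hs, rfl⟩, ?_⟩
    · rw [Finset.mem_coe, hS, Fintype.mem_piFinset]
      intro j
      obtain ⟨h1, h2⟩ := abs_le.mp (hq j)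
      rw [Finset.mem_Icc]
      refine ⟨?_, Int.le_floor.mpr h2⟩
      rw [neg_le, hN, Int.le_floor]
      push_cast
      linarith
    · change P.toFun _ + P.toFun s = ∑ j, (m j : ℝ) • P.gens j
      unfold toFun
      rw [← Finset.sum_add_distrib]
      refine Finset.sum_congr rfl fun j _ => ?_
      rw [← add_smul, hqs j]
      push_cast
      rfl
  have hfin : ((S : Set (Fin P.rank → ℤ)) ×ˢ P.image).Finite := S.finite_toSet.prod P.finite_image
  have h1 : (P.dilate T).size ≤ S.card * P.size := by
    calc (P.dilate T).size ≤ (f '' ((S : Set (Fin P.rank → ℤ)) ×ˢ P.image)).ncard :=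
          Set.ncard_le_ncard hsub (hfin.image f)
      _ ≤ ((S : Set (Fin P.rank → ℤ)) ×ˢ P.image).ncard := Set.ncard_image_le hfin
      _ = S.card * P.size := by rw [Set.ncard_prod, Set.ncard_coe_finset]; rfl
  calc ((P.dilate T).size : ℝ) ≤ S.card * P.size := by exact_mod_cast h1
    _ ≤ (4 * T) ^ P.rank * P.size := by gcongr

/-- The coefficient lattice of a GAP, scaled so that its box becomes a cube. -/
noncomputable def scaledPoint (P : GAP ℝ) :
    (Fin P.rank → ℤ) →+ EuclideanSpace ℝ (Fin P.rank) where
  toFun m := WithLp.toLp 2 fun j => (m j : ℝ) / P.dims j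
  map_zero' := by
    ext j
    simp
  map_add' m m' := by
    ext j
    simp [add_div]

theorem scaledPoint_apply (P : GAP ℝ) (m : Fin P.rank → ℤ) (j : Fin P.rank) :
    P.scaledPoint m j = (m j : ℝ) / P.dims j := rfl

/-- The linear functional on the scaled coefficient space induced by the generators. -/
noncomputable def scaledMap (P : GAP ℝ) : EuclideanSpace ℝ (Fin P.rank) →ₗ[ℝ] ℝ :=
  ∑ j, (P.dims j * P.gens j) • (EuclideanSpace.proj j).toLinearMap

theorem scaledMap_scaledPoint (P : GAP ℝ) (hdims : ∀ j, 0 < P.dims j) (m : Fin P.rank → ℤ) :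
    P.scaledMap (P.scaledPoint m) = P.toFun m := by
  have h : P.scaledMap (P.scaledPoint m) =
      ∑ j, (P.dims j * P.gens j) * ((m j : ℝ) / P.dims j) := by
    simp [scaledMap, scaledPoint_apply]
  rw [h, toFun]
  refine Finset.sum_congr rfl fun j _ => ?_
  have := (hdims j).ne'
  rw [smul_eq_mul]
  field_simp

theorem mem_box_dilate_of_norm_le (P : GAP ℝ) (hdims : ∀ j, 0 < P.dims j) {R : ℝ}
    {m : Fin P.rank → ℤ} (hm : ‖P.scaledPoint m‖ ≤ R) : m ∈ (P.dilate R).box := by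
  intro (j : Fin P.rank)
  have h := (PiLp.norm_apply_le (P.scaledPoint m) j).trans hm
  rw [scaledPoint_apply, Real.norm_eq_abs, abs_div, abs_of_pos (hdims j),
    div_le_iff₀ (hdims j)] at h
  exact h

theorem norm_scaledPoint_le (P : GAP ℝ) (hdims : ∀ j, 0 < P.dims j) {m : Fin P.rank → ℤ}
    (hm : m ∈ P.box) : ‖P.scaledPoint m‖ ≤ √P.rank := by
  rw [EuclideanSpace.norm_eq]
  refine Real.sqrt_le_sqrt ?_
  calc ∑ j, ‖P.scaledPoint m j‖ ^ 2 ≤ ∑ _j : Fin P.rank, (1 : ℝ) := by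
        refine Finset.sum_le_sum fun j _ => pow_le_one₀ (norm_nonneg _) ?_
        rw [scaledPoint_apply, Real.norm_eq_abs, abs_div, abs_of_pos (hdims j)]
        exact (div_le_one (hdims j)).mpr (hm j)
    _ = P.rank := by simp

theorem locallyFiniteGroup_range_scaledPoint (P : GAP ℝ) (hdims : ∀ j, 0 < P.dims j) :
    LocallyFiniteGroup P.scaledPoint.range := by
  intro R
  refine ((P.dilate R).finite_box.image P.scaledPoint).subset ?_
  rintro _ ⟨⟨m, rfl⟩, hm⟩
  exact ⟨m, P.mem_box_dilate_of_norm_le hdims hm, rfl⟩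

/-- Any GAP is contained in a `t`-proper GAP which is contained in a controlled dilate. -/
theorem exists_tProper_between (P : GAP ℝ) (hrank : 1 ≤ P.rank) (hdims : ∀ j, 0 < P.dims j)
    {t : ℝ} (ht : 1 ≤ t) :
    ∃ Q : GAP ℝ, (∀ j, 0 < Q.dims j) ∧ Q.rank ≤ P.rank ∧ Q.TProper t ∧ P.image ⊆ Q.image ∧
      Q.image ⊆
        (P.dilate (2 * (2 ^ P.rank * P.rank.factorial) * P.rank ^ 2 * t)).image := by
  set r := P.rank with hr
  set C : ℝ := 2 ^ r * r.factorial with hC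
  have hCpos : 0 < C := by positivity
  have hr1 : (1 : ℝ) ≤ r := by exact_mod_cast hrank
  have hsq : √(r : ℝ) ^ 2 = r := Real.sq_sqrt (by positivity)
  have hsqpos : 0 < √(r : ℝ) := Real.sqrt_pos.mpr (by positivity)
  set τ : ℝ := 2 * t * (r * (C * √r)) with hτ
  obtain ⟨Λ, hΛ, hrk, hdown, hup, hker⟩ :=
    LocallyFiniteGroup.exists_no_short_kernel P.scaledMap τ r _
      (P.locallyFiniteGroup_range_scaledPoint hdims)
      ((Submodule.finrank_le _).trans (by simp [hr]))
  obtain ⟨d, hd, b, hb0, hbΛ, hgen, hbd⟩ :=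
    LocallyFiniteGroup.exists_reduced_basis r Λ hΛ hrk
  have hbpos : ∀ j, 0 < ‖b j‖ := fun j => norm_pos_iff.mpr (hb0 j)
  have hdr : (d : ℝ) ≤ r := by exact_mod_cast hd
  have hmem : ∀ m : Fin d → ℤ, ∑ j, (m j : ℝ) • b j ∈ Λ := fun m =>
    Λ.sum_mem fun j _ => by
      rw [Int.cast_smul_eq_zsmul]
      exact Λ.zsmul_mem (hbΛ j) _
  have hφ : ∀ m : Fin d → ℤ, P.scaledMap (∑ j, (m j : ℝ) • b j) =
      ∑ j, (m j : ℝ) • P.scaledMap (b j) := fun m => by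
    simp only [map_sum, map_smul]
  have hnorm : ∀ (m : Fin d → ℤ) (u : ℝ), 0 ≤ u →
      (∀ j, |(m j : ℝ)| ≤ u * (C * √r / ‖b j‖)) →
      ‖∑ j, (m j : ℝ) • b j‖ ≤ u * (r * (C * √r)) := fun m u hu hm => by
    calc ‖∑ j, (m j : ℝ) • b j‖ ≤ ∑ j, ‖(m j : ℝ) • b j‖ := norm_sum_le _ _
      _ ≤ ∑ _j : Fin d, u * (C * √r) := by
        refine Finset.sum_le_sum fun j _ => ?_
        rw [norm_smul, Real.norm_eq_abs, ← le_div_iff₀ (hbpos j), mul_div_assoc]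
        exact hm j
      _ = d * (u * (C * √r)) := by simp
      _ ≤ r * (u * (C * √r)) := by gcongr
      _ = u * (r * (C * √r)) := by ring
  refine ⟨⟨d, fun j => C * √r / ‖b j‖, fun j => P.scaledMap (b j)⟩,
    fun j => div_pos (by positivity) (hbpos j), hd, ?_, ?_, ?_⟩
  · intro m hm m' hm' heq
    change Fin d → ℤ at m m'
    change ∀ j : Fin d, |(m j : ℝ)| ≤ t * (C * √r / ‖b j‖) at hm
    change ∀ j : Fin d, |(m' j : ℝ)| ≤ t * (C * √r / ‖b j‖) at hm'
    change ∑ j : Fin d, (m j : ℝ) • P.scaledMap (b j) =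
      ∑ j : Fin d, (m' j : ℝ) • P.scaledMap (b j) at heq
    have hz : ∑ j, ((m - m') j : ℝ) • b j = 0 := by
      refine hker _ (hmem _) ?_ (hnorm _ (2 * t) (by positivity) fun j => ?_)
      · rw [hφ]
        simp only [Pi.sub_apply, Int.cast_sub, sub_smul, Finset.sum_sub_distrib, heq, sub_self]
      · have h1 := abs_sub (m j : ℝ) (m' j)
        rw [Pi.sub_apply, Int.cast_sub]
        linarith [hm j, hm' j]
    funext j
    have h1 := hbd (m - m') j
    rw [hz, norm_zero, mul_zero] at h1
    have h2 : |((m - m') j : ℝ)| ≤ 0 := le_of_mul_le_mul_right (by simpa using h1) (hbpos j)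
    have h3 : ((m - m') j : ℝ) = 0 := abs_nonpos_iff.mp h2
    exact sub_eq_zero.mp (by exact_mod_cast h3)
  · rintro _ ⟨m, hm, rfl⟩
    obtain ⟨y, hy, hyn, hyφ⟩ := hdown _ ⟨m, rfl⟩
    obtain ⟨a, rfl⟩ := hgen y hy
    refine ⟨a, fun j => ?_, ?_⟩
    · change |(a j : ℝ)| ≤ C * √r / ‖b j‖
      rw [le_div_iff₀ (hbpos j)]
      refine (hbd a j).trans ?_
      gcongr
      exact hyn.trans (P.norm_scaledPoint_le hdims hm)
    · rw [← P.scaledMap_scaledPoint hdims m, ← hyφ, hφ]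
      rfl
  · rintro _ ⟨a, ha, rfl⟩
    change ∀ j : Fin d, |(a j : ℝ)| ≤ C * √r / ‖b j‖ at ha
    obtain ⟨_, ⟨m, rfl⟩, hmn, hmφ⟩ := hup _ (hmem a)
    refine ⟨m, P.mem_box_dilate_of_norm_le hdims ?_, ?_⟩
    · refine le_of_sq_le_sq (hmn.trans ?_) (by positivity)
      have h1 := pow_le_pow_left₀ (norm_nonneg _) (hnorm a 1 zero_le_one fun j => by
        simpa using ha j) 2
      have h2 : (1 * (r * (C * √r))) ^ 2 = (C ^ 2 * r ^ 3 : ℝ) := by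
        rw [one_mul, mul_pow, mul_pow, hsq]
        ring
      have h3 : r * (τ ^ 2 / 4) = C ^ 2 * r ^ 4 * t ^ 2 := by
        rw [hτ, mul_pow, mul_pow, mul_pow, mul_pow, hsq]
        ring
      rw [h2] at h1
      rw [h3]
      have h4 : C ^ 2 * r ^ 3 ≤ C ^ 2 * r ^ 4 * t ^ 2 := by
        calc C ^ 2 * (r : ℝ) ^ 3 ≤ C ^ 2 * r ^ 4 :=
              mul_le_mul_of_nonneg_left (pow_le_pow_right₀ hr1 (by norm_num)) (by positivity)
          _ ≤ C ^ 2 * r ^ 4 * t ^ 2 := le_mul_of_one_le_right (by positivity) (one_le_pow₀ ht)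
      have h5 : 0 ≤ C ^ 2 * r ^ 4 * t ^ 2 := by positivity
      have h6 : (2 * C * r ^ 2 * t) ^ 2 = 4 * (C ^ 2 * r ^ 4 * t ^ 2) := by ring
      rw [h6]
      linarith
    · change P.toFun m = ∑ j : Fin d, (a j : ℝ) • P.scaledMap (b j)
      rw [← P.scaledMap_scaledPoint hdims m, hmφ, hφ]

theorem four_mul_two_pow_mul_factorial_mul_sq_le {r : ℕ} (hr : 2 ≤ r) :
    4 * (2 ^ r * r.factorial) * r ^ 2 ≤ r ^ (6 * r) := by
  calc 4 * (2 ^ r * r.factorial) * r ^ 2 ≤ r ^ 2 * (r ^ r * r ^ r) * r ^ 2 := by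
        gcongr
        · nlinarith
        · exact r.factorial_le_pow
    _ = r ^ (2 * r + 4) := by ring
    _ ≤ r ^ (6 * r) := Nat.pow_le_pow_right (by omega) (by omega)

/-- A rank one GAP lies in a GAP of the same size and rank at most one which is `t`-proper. -/
theorem exists_tProper_of_rank_eq_one (P : GAP ℝ) (hrank : P.rank = 1)
    (hdims : ∀ j, 0 < P.dims j) (t : ℝ) :
    ∃ Q : GAP ℝ, (∀ j, 0 < Q.dims j) ∧ Q.rank ≤ P.rank ∧ Q.TProper t ∧ P.image = Q.image := by
  by_cases hg : ∀ j, P.gens j = 0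
  · refine ⟨⟨0, Fin.elim0, Fin.elim0⟩, fun j => j.elim0, Nat.zero_le _,
      fun m _ m' _ _ => funext fun j => j.elim0, ?_⟩
    ext x
    constructor
    · rintro ⟨m, -, rfl⟩
      refine ⟨Fin.elim0, fun j => j.elim0, ?_⟩
      simp [toFun, hg]
    · rintro ⟨m, -, rfl⟩
      simpa [toFun] using P.zero_mem_image hdims
  · refine ⟨P, hdims, le_rfl, fun m _ m' _ heq => ?_, rfl⟩
    push Not at hg
    obtain ⟨i, hi⟩ := hg
    obtain ⟨r, L, g⟩ := P
    subst hrank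
    change Fin 1 → ℤ at m m'
    change ∑ j : Fin 1, (m j : ℝ) • g j = ∑ j : Fin 1, (m' j : ℝ) • g j at heq
    change Fin 1 at i
    obtain rfl : i = 0 := Subsingleton.elim _ _
    rw [Fin.sum_univ_one, Fin.sum_univ_one, smul_eq_mul, smul_eq_mul] at heq
    have h := mul_right_cancel₀ hi heq
    funext j
    obtain rfl : j = 0 := Subsingleton.elim _ _
    exact_mod_cast h

end GAP

theorem stmt_5 (P : GAP ℝ) (hrank : 1 ≤ P.rank) (hdims : ∀ j, 0 < P.dims j)
    (t : ℝ) (ht : 1 ≤ t) :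
    ∃ Q : GAP ℝ,
      (∀ j, 0 < Q.dims j) ∧
      Q.rank ≤ P.rank ∧
      Q.TProper t ∧
      P.image ⊆ Q.image ∧
      P.size ≤ Q.size ∧
      (Q.size : ℝ) ≤ (2 * t) ^ P.rank * (P.rank : ℝ) ^ (6 * P.rank ^ 2) * (P.size : ℝ) := by
  rcases hrank.eq_or_lt with h1 | h2
  · obtain ⟨Q, hQ, hQr, hQt, hPQ⟩ := P.exists_tProper_of_rank_eq_one h1.symm hdims t
    refine ⟨Q, hQ, hQr, hQt, hPQ.subset, (congrArg Set.ncard hPQ).le, ?_⟩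
    have hsize : Q.size = P.size := congrArg Set.ncard hPQ.symm
    rw [hsize, ← h1, Nat.cast_one, one_pow, mul_one, pow_one]
    exact le_mul_of_one_le_left (Nat.cast_nonneg _) (by linarith)
  · obtain ⟨Q, hQ, hQr, hQt, hPQ, hQP⟩ := P.exists_tProper_between hrank hdims ht
    refine ⟨Q, hQ, hQr, hQt, hPQ, Set.ncard_le_ncard hPQ Q.finite_image, ?_⟩
    set r := P.rank with hr
    set T : ℝ := 2 * (2 ^ r * r.factorial) * r ^ 2 * t with hT
    have hnum : (4 * (2 ^ r * r.factorial) * r ^ 2 : ℝ) ≤ (r : ℝ) ^ (6 * r) := by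
      exact_mod_cast GAP.four_mul_two_pow_mul_factorial_mul_sq_le (r := r) h2
    have hT1 : 1 ≤ T := by
      have h : 1 ≤ 2 * (2 ^ r * r.factorial) * r ^ 2 := Nat.one_le_iff_ne_zero.mpr (by positivity)
      have h' : (1 : ℝ) ≤ 2 * (2 ^ r * r.factorial) * r ^ 2 := by exact_mod_cast h
      exact one_le_mul_of_one_le_of_one_le h' ht
    calc (Q.size : ℝ) ≤ (P.dilate T).size := by
          exact_mod_cast Set.ncard_le_ncard hQP (P.dilate T).finite_image
      _ ≤ (4 * T) ^ r * P.size := P.size_dilate_le hdims hT1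
      _ ≤ (2 * t * (r : ℝ) ^ (6 * r)) ^ r * P.size := by
          refine mul_le_mul_of_nonneg_right ?_ (Nat.cast_nonneg _)
          refine pow_le_pow_left₀ (by positivity) ?_ _
          rw [hT]
          nlinarith
      _ = (2 * t) ^ r * (r : ℝ) ^ (6 * r ^ 2) * P.size := by
          rw [mul_pow (2 * t), ← pow_mul]
          ring_nf
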